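/- arXiv:1202.0668 — 2 statements merged into one kernel-verified Lean document; each statement's English description precedes it below -/
import Mathlib

section
/- In the purely fermionic case (m = 0), the Grassmann algebra Λ_{2n} decomposes as Λ_{2n} = ⊕_{k=0}^{n} ⊕_{j=0}^{n-k} θ^{2j} H^f_k, where θ² = −Σ_{j=1}^n x'_{2j-1}x'_{2j} and H^f_k are the fermionic spherical harmonics of degree k. -/
open scoped TensorProduct
open MvPolynomial
set_option synthInstance.maxHeartbeats 1000000
set_option maxHeartbeats 1000000

noncomputable section

/-- The Grassmann algebra on `N` anticommuting generators, modelled as the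
exterior algebra of `ℝ^N`. -/
abbrev GrassAlg (N : ℕ) : Type _ := ExteriorAlgebra ℝ (Fin N → ℝ)

/-- The Grassmann generators `x'_j`. -/
def gGen {N : ℕ} (j : Fin N) : GrassAlg N := ExteriorAlgebra.ι ℝ (Pi.single j 1)

/-- The (left) Grassmann derivative `∂_{x'_j}`, an odd derivation of the Grassmann
algebra, realized as left contraction with the `j`-th dual basis vector. -/
def gDer {N : ℕ} (j : Fin N) : GrassAlg N →ₗ[ℝ] GrassAlg N :=
  CliffordAlgebra.contractLeft (LinearMap.proj j)

/-- The index `2j-1` (1-based), i.e. `2j` (0-based). -/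
def fi1 {n : ℕ} (j : Fin n) : Fin (2 * n) := ⟨2 * j.1, by have := j.isLt; omega⟩

/-- The index `2j` (1-based), i.e. `2j+1` (0-based). -/
def fi2 {n : ℕ} (j : Fin n) : Fin (2 * n) := ⟨2 * j.1 + 1, by have := j.isLt; omega⟩

/-- `θ² = - Σ_j x'_{2j-1} x'_{2j}`. -/
def thetaSq (n : ℕ) : GrassAlg (2 * n) :=
  - ∑ j : Fin n, gGen (fi1 j) * gGen (fi2 j)

/-- The fermionic Laplacian `∇²_f = -4 Σ_j ∂_{x'_{2j-1}} ∂_{x'_{2j}}`. -/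
def fLap (n : ℕ) : Module.End ℝ (GrassAlg (2 * n)) :=
  -(4 : ℝ) • ∑ j : Fin n, gDer (fi1 j) * gDer (fi2 j)

/-- The fermionic Euler operator `𝔼_f = Σ_j x'_j ∂_{x'_j}`. -/
def fEuler (N : ℕ) : Module.End ℝ (GrassAlg N) :=
  ∑ j : Fin N, LinearMap.mulLeft ℝ (gGen j) * gDer j

/-- Fermionic spherical harmonics of degree `k`. -/
def fHarm (n k : ℕ) : Submodule ℝ (GrassAlg (2 * n)) :=
  Module.End.eigenspace (fEuler (2 * n)) (k : ℝ) ⊓ LinearMap.ker (fLap n)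

/-- The algebra of super polynomials `P = ℝ[x_1,…,x_m] ⊗ Λ_{2n}`. -/
abbrev SP (m n : ℕ) : Type _ := MvPolynomial (Fin m) ℝ ⊗[ℝ] GrassAlg (2 * n)

variable (m n : ℕ)

/-- Multiplication by the bosonic variable `x_i`. -/
def bvar (i : Fin m) : Module.End ℝ (SP m n) :=
  LinearMap.rTensor _ (LinearMap.mulLeft ℝ (X i))

/-- The bosonic derivative `∂_{x_i}`. -/
def bder (i : Fin m) : Module.End ℝ (SP m n) :=
  LinearMap.rTensor _ (pderiv i).toLinearMap

/-- Multiplication by the fermionic variable `x'_j`. -/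
def fvar (j : Fin (2 * n)) : Module.End ℝ (SP m n) :=
  LinearMap.lTensor _ (LinearMap.mulLeft ℝ (gGen j))

/-- The fermionic derivative `∂_{x'_j}` on super polynomials. -/
def fderSP (j : Fin (2 * n)) : Module.End ℝ (SP m n) :=
  LinearMap.lTensor _ (gDer j)

/-- The super Laplace operator `∇² = Σ_i ∂²_{x_i} - 4 Σ_j ∂_{x'_{2j-1}} ∂_{x'_{2j}}`. -/
def superLap : Module.End ℝ (SP m n) :=
  ∑ i : Fin m, bder m n i * bder m n i
    - (4 : ℝ) • ∑ j : Fin n, fderSP m n (fi1 j) * fderSP m n (fi2 j)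

/-- The super Euler operator `𝔼 = Σ_i x_i ∂_{x_i} + Σ_j x'_j ∂_{x'_j}`. -/
def superEuler : Module.End ℝ (SP m n) :=
  ∑ i : Fin m, bvar m n i * bder m n i + ∑ j : Fin (2 * n), fvar m n j * fderSP m n j

/-- The generalized norm squared `R² = Σ_i x_i² - Σ_j x'_{2j-1} x'_{2j}`. -/
def rSq : SP m n := (∑ i : Fin m, X i * X i) ⊗ₜ[ℝ] 1 + 1 ⊗ₜ[ℝ] thetaSq n

/-- Multiplication by `R²`. -/
def mulRSq : Module.End ℝ (SP m n) := LinearMap.mulLeft ℝ (rSq m n)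

/-- Super polynomials of homogeneous degree `k` (eigenspace of the Euler operator). -/
def Pdeg (k : ℕ) : Submodule ℝ (SP m n) :=
  Module.End.eigenspace (superEuler m n) (k : ℝ)

/-- Spherical harmonics of degree `k`: degree-`k` null-solutions of `∇²`. -/
def Harm (k : ℕ) : Submodule ℝ (SP m n) :=
  Pdeg m n k ⊓ LinearMap.ker (superLap m n)

/-- Evaluation at the origin: the scalar part of a super polynomial. -/
def scalarPart : SP m n →ₐ[ℝ] ℝ :=
  Algebra.TensorProduct.productMap (aeval fun _ => (0 : ℝ)) ExteriorAlgebra.algebraMapInv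

/-- Parity `[i]` of the super coordinates: `0` for bosonic, `1` for fermionic. -/
def par (i : Fin (m + 2 * n)) : ℕ := if i.1 < m then 0 else 1

/-- The orthosymplectic metric `g^{ij}` (identity bosonic block, `J`-type fermionic
block with entries `∓ 1/2`). -/
def gUp (i j : Fin (m + 2 * n)) : ℝ :=
  if i.1 < m ∧ j.1 < m then (if i = j then 1 else 0)
  else if m ≤ i.1 ∧ j.1 = i.1 + 1 ∧ (i.1 - m) % 2 = 0 then -(1 / 2)
  else if m ≤ j.1 ∧ i.1 = j.1 + 1 ∧ (j.1 - m) % 2 = 0 then 1 / 2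
  else 0

/-- The inverse orthosymplectic metric `g_{ij}`. -/
def gDown (i j : Fin (m + 2 * n)) : ℝ :=
  if i.1 < m ∧ j.1 < m then (if i = j then 1 else 0)
  else if m ≤ i.1 ∧ j.1 = i.1 + 1 ∧ (i.1 - m) % 2 = 0 then 2
  else if m ≤ j.1 ∧ i.1 = j.1 + 1 ∧ (j.1 - m) % 2 = 0 then -2
  else 0

/-- Multiplication by the super coordinate `X_i`. -/
def svar (i : Fin (m + 2 * n)) : Module.End ℝ (SP m n) :=
  if h : i.1 < m then bvar m n ⟨i.1, h⟩
  else fvar m n ⟨i.1 - m, by have := i.isLt; omega⟩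

/-- The super derivative `∂_{X_i}`. -/
def sder (i : Fin (m + 2 * n)) : Module.End ℝ (SP m n) :=
  if h : i.1 < m then bder m n ⟨i.1, h⟩
  else fderSP m n ⟨i.1 - m, by have := i.isLt; omega⟩

/-- The raised super derivative `∂_{X^j}`. -/
def sderUp (j : Fin (m + 2 * n)) : Module.End ℝ (SP m n) :=
  ∑ k : Fin (m + 2 * n), gDown m n j k • sder m n k

/-- The `osp(m|2n)` generators `L_{ij} = X_i ∂_{X^j} - (-1)^{[i][j]} X_j ∂_{X^i}`. -/
def Lgen (i j : Fin (m + 2 * n)) : Module.End ℝ (SP m n) :=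
  svar m n i * sderUp m n j
    - ((-1 : ℝ) ^ (par m n i * par m n j)) • (svar m n j * sderUp m n i)

/-- The Laplace–Beltrami operator `Δ_LB = R²∇² - 𝔼(M - 2 + 𝔼)`. -/
def lapBeltrami : Module.End ℝ (SP m n) :=
  mulRSq m n * superLap m n
    - superEuler m n *
        ((((m : ℝ) - 2 * n) - 2) • (1 : Module.End ℝ (SP m n)) + superEuler m n)

/-- The bosonic Laplacian on ordinary polynomials. -/
def bLap : Module.End ℝ (MvPolynomial (Fin m) ℝ) :=
  ∑ i : Fin m, (pderiv i).toLinearMap * (pderiv i).toLinearMap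


section FischerAbstract

/-- Powers of the raising operator raise the eigenvalue of `E` by two. -/
theorem fischer_E_pow {V : Type*} [AddCommGroup V] [Module ℝ V] (E L : Module.End ℝ V)
    (hEL : ∀ v, E (L v) = L (E v) + (2 : ℝ) • L v) (μ : ℝ) (v : V) (hv : E v = μ • v) (j : ℕ) :
    E ((L ^ j) v) = (μ + 2 * j) • (L ^ j) v := by
  induction j with
  | zero => simp [hv]
  | succ j ih =>
    rw [pow_succ', Module.End.mul_apply, hEL, ih, map_smul]
    push_cast
    module

/-- The basic `sl₂` commutation formula. -/
theorem fischer_D_pow {V : Type*} [AddCommGroup V] [Module ℝ V] (E L D : Module.End ℝ V) (c : ℝ)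
    (hDL : ∀ v, D (L v) = L (D v) + (4 : ℝ) • (E v - c • v))
    (hEL : ∀ v, E (L v) = L (E v) + (2 : ℝ) • L v) (μ : ℝ) (v : V) (hv : E v = μ • v)
    (h0 : L (D v) = 0) (j : ℕ) :
    D ((L ^ (j + 1)) v) = (4 * (j + 1) * (μ + j - c)) • (L ^ j) v := by
  induction j with
  | zero => simp [hDL, h0, hv]; module
  | succ j ih =>
    rw [pow_succ', Module.End.mul_apply, hDL, ih, fischer_E_pow E L hEL μ v hv, map_smul,
      ← Module.End.mul_apply L, ← pow_succ']
    push_cast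
    module

/-- No vector of weight above the middle is killed by `L D`. -/
theorem fischer_inj {V : Type*} [AddCommGroup V] [Module ℝ V] [FiniteDimensional ℝ V]
    (E L D : Module.End ℝ V) (c : ℝ)
    (hDL : ∀ v, D (L v) = L (D v) + (4 : ℝ) • (E v - c • v))
    (hEL : ∀ v, E (L v) = L (E v) + (2 : ℝ) • L v) (μ : ℝ) (v : V) (hv : E v = μ • v)
    (h0 : L (D v) = 0) (hμ : c < μ) : v = 0 := by
  by_contra hne
  have hall : ∀ j : ℕ, (L ^ j) v ≠ 0 := by
    intro j
    induction j with
    | zero => simpa using hne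
    | succ j ih =>
      intro h
      have := fischer_D_pow E L D c hDL hEL μ v hv h0 j
      rw [h, map_zero] at this
      rcases smul_eq_zero.1 this.symm with h1 | h1
      · have : 0 < 4 * ((j : ℝ) + 1) * (μ + j - c) := by
          have : (0 : ℝ) ≤ j := Nat.cast_nonneg j
          apply mul_pos <;> linarith
        linarith
      · exact ih h1
  have hinj : Function.Injective (fun j : ℕ => μ + 2 * (j : ℝ)) := by
    intro a b h
    have h' : (a : ℝ) = b := by simp only at h; linarith
    exact_mod_cast h'
  refine Set.infinite_range_of_injective hinj (E.finite_hasEigenvalue.subset ?_)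
  rintro _ ⟨j, rfl⟩
  exact Module.End.hasEigenvalue_of_hasEigenvector
    ⟨Module.End.mem_eigenspace_iff.2 (fischer_E_pow E L hEL μ v hv j), hall j⟩

/-- An operator preserving an eigenspace and injective there is onto the eigenspace. -/
theorem fischer_surj {V : Type*} [AddCommGroup V] [Module ℝ V] [FiniteDimensional ℝ V]
    (E T : Module.End ℝ V) (μ : ℝ) (hT : ∀ v, E v = μ • v → E (T v) = μ • T v)
    (hinj : ∀ v, E v = μ • v → T v = 0 → v = 0) (x : V) (hx : E x = μ • x) :
    ∃ y, E y = μ • y ∧ T y = x := by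
  have hmem : ∀ v ∈ E.eigenspace μ, T v ∈ E.eigenspace μ := fun v hv =>
    Module.End.mem_eigenspace_iff.2 (hT v (Module.End.mem_eigenspace_iff.1 hv))
  have hi : Function.Injective (T.restrict hmem) := by
    rw [injective_iff_map_eq_zero]
    intro a ha
    apply Subtype.ext
    exact hinj a (Module.End.mem_eigenspace_iff.1 a.2) (congrArg Subtype.val ha)
  obtain ⟨y, hy⟩ := (LinearMap.injective_iff_surjective.1 hi) ⟨x, Module.End.mem_eigenspace_iff.2 hx⟩
  exact ⟨y, Module.End.mem_eigenspace_iff.1 y.2, congrArg Subtype.val hy⟩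

theorem fischer_abstract {V : Type*} [AddCommGroup V] [Module ℝ V] [FiniteDimensional ℝ V]
    (E L D : Module.End ℝ V) (n : ℕ)
    (hDL : ∀ v, D (L v) = L (D v) + (4 : ℝ) • (E v - (n : ℝ) • v))
    (hEL : ∀ v, E (L v) = L (E v) + (2 : ℝ) • L v)
    (hED : ∀ v, E (D v) = D (E v) - (2 : ℝ) • D v)
    (htop : ⨆ k : ℕ, E.eigenspace (k : ℝ) = ⊤) :
    DirectSum.IsInternal
      (fun p : { p : ℕ × ℕ // p.1 ≤ n ∧ p.2 ≤ n - p.1 } =>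
        Submodule.map (L ^ p.1.2)
          (E.eigenspace ((p.1.1 : ℕ) : ℝ) ⊓ LinearMap.ker D)) := by
  -- the operator `(n+1) L D + E` separates the summands
  have hindep : iSupIndep (fun p : { p : ℕ × ℕ // p.1 ≤ n ∧ p.2 ≤ n - p.1 } =>
        Submodule.map (L ^ p.1.2)
          (E.eigenspace ((p.1.1 : ℕ) : ℝ) ⊓ LinearMap.ker D)) := by
    let f : { p : ℕ × ℕ // p.1 ≤ n ∧ p.2 ≤ n - p.1 } → ℝ := fun p =>
      ((n : ℝ) + 1) * (4 * p.1.2 * ((p.1.1 : ℝ) + p.1.2 - 1 - n)) + (p.1.1 + 2 * p.1.2)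
    have hf : Function.Injective f := by
      rintro ⟨⟨k, j⟩, hk, hj⟩ ⟨⟨k', j'⟩, hk', hj'⟩ h
      simp only [f] at h hk hj hk' hj'
      have h2 : ((n : ℤ) + 1) * (4 * j * ((k : ℤ) + j - 1 - n)) + (k + 2 * j)
          = ((n : ℤ) + 1) * (4 * j' * ((k' : ℤ) + j' - 1 - n)) + (k' + 2 * j') := by
        exact_mod_cast h
      have h3 : (k' + 2 * j' : ℤ) - (k + 2 * j) = 0 := by
        apply Int.eq_zero_of_abs_lt_dvd (m := 4 * ((n : ℤ) + 1))
        · exact ⟨j * ((k : ℤ) + j - 1 - n) - j' * ((k' : ℤ) + j' - 1 - n), by linarith⟩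
        · rw [abs_lt]; constructor <;> omega
      have h4 : (j : ℤ) * ((k : ℤ) + j - 1 - n) = j' * ((k' : ℤ) + j' - 1 - n) := by
        have : ((n : ℤ) + 1) * (j * ((k : ℤ) + j - 1 - n) - j' * ((k' : ℤ) + j' - 1 - n)) = 0 := by
          linarith
        rcases mul_eq_zero.1 this with h5 | h5
        · omega
        · linarith
      have hk2 : (k' : ℤ) = k + 2 * j - 2 * j' := by linarith
      have h5 : ((j : ℤ) - j') * (k + j - j' - 1 - n) = 0 := by
        rw [hk2] at h4; linarith
      have : j = j' := by
        rcases mul_eq_zero.1 h5 with h6 | h6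
        · omega
        · omega
      subst this
      have : k = k' := by omega
      subst this
      rfl
    refine ((((n : ℝ) + 1) • (L * D) + E).eigenspaces_iSupIndep.comp hf).mono ?_
    rintro ⟨⟨k, j⟩, hk, hj⟩ _ ⟨h, ⟨hh1, hh2⟩, rfl⟩
    have hh1' := Module.End.mem_eigenspace_iff.1 hh1
    have hh2' : D h = 0 := hh2
    simp only [Function.comp, f]
    rw [Module.End.mem_eigenspace_iff, LinearMap.add_apply, LinearMap.smul_apply,
      Module.End.mul_apply, fischer_E_pow E L hEL _ h hh1']
    cases j with
    | zero => simp [hh2']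
    | succ j =>
      rw [fischer_D_pow E L D n hDL hEL _ h hh1' (by simp [hh2']), map_smul,
        ← Module.End.mul_apply L, ← pow_succ']
      push_cast
      module
  refine DirectSum.isInternal_submodule_of_iSupIndep_of_iSup_eq_top hindep ?_
  set A := (fun p : { p : ℕ × ℕ // p.1 ≤ n ∧ p.2 ≤ n - p.1 } =>
        Submodule.map (L ^ p.1.2)
          (E.eigenspace ((p.1.1 : ℕ) : ℝ) ⊓ LinearMap.ker D)) with hA
  -- negative eigenvalues do not occur
  have hneg : ∀ (μ : ℝ) (v : V), μ < 0 → E v = μ • v → v = 0 := by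
    intro μ v hμ hv
    have h1 := E.eigenspaces_iSupIndep μ
    have h2 : (⨆ (ν : ℝ) (_ : ν ≠ μ), E.eigenspace ν) = ⊤ := by
      rw [eq_top_iff, ← htop]
      refine iSup_le fun k => ?_
      refine le_iSup₂_of_le (k : ℝ) ?_ le_rfl
      have : (0 : ℝ) ≤ k := Nat.cast_nonneg k
      linarith
    rw [h2, disjoint_top] at h1
    have h3 := Module.End.mem_eigenspace_iff.2 hv
    rw [h1] at h3
    simpa using h3
  -- the sum is stable under `L`
  have hLS : ∀ x ∈ iSup A, L x ∈ iSup A := by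
    intro x hx
    suffices iSup A ≤ (iSup A).comap L from this hx
    refine iSup_le ?_
    rintro ⟨⟨k, j⟩, hk, hj⟩ _ ⟨h, ⟨hh1, hh2⟩, rfl⟩
    rw [Submodule.mem_comap, ← Module.End.mul_apply, ← pow_succ']
    by_cases hj' : j + 1 ≤ n - k
    · exact Submodule.mem_iSup_of_mem (p := A) ⟨(k, j + 1), hk, hj'⟩ ⟨h, ⟨hh1, hh2⟩, rfl⟩
    · have hh1' := Module.End.mem_eigenspace_iff.1 hh1
      have hh2' : D h = 0 := hh2
      have hjk : (k : ℝ) + j = n := by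
        simp only at hk hj
        have : k + j = n := by omega
        exact_mod_cast this
      have hz : (L ^ (j + 1)) h = 0 := by
        refine fischer_inj E L D n hDL hEL _ _ (fischer_E_pow E L hEL _ h hh1' (j + 1)) ?_ ?_
        · rw [fischer_D_pow E L D n hDL hEL _ h hh1' (by simp [hh2']), hjk]
          simp
        · push_cast
          have : (0 : ℝ) ≤ j := Nat.cast_nonneg j
          linarith
      show (L ^ (j + 1)) h ∈ iSup A
      rw [hz]
      exact Submodule.zero_mem _
  rw [eq_top_iff, ← htop]
  refine iSup_le fun k => ?_
  induction k using Nat.strong_induction_on with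
  | _ k ih =>
  -- membership of vectors of weight `k - 2`
  have ih' : ∀ y, E y = ((k : ℝ) - 2) • y → L y ∈ iSup A := by
    intro y hy
    apply hLS
    by_cases hk : 2 ≤ k
    · apply ih (k - 2) (by omega)
      rw [Module.End.mem_eigenspace_iff, hy]
      push_cast [hk]
      rfl
    · have : y = 0 := hneg _ y (by
        have : (k : ℝ) < 2 := by exact_mod_cast not_le.1 hk
        linarith) hy
      rw [this]
      exact Submodule.zero_mem _
  intro x hx
  have hx' := Module.End.mem_eigenspace_iff.1 hx
  have hDx : ∀ z, E z = (k : ℝ) • z → E (D z) = ((k : ℝ) - 2) • D z := by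
    intro z hz
    rw [hED, hz, map_smul]
    module
  by_cases hkn : k ≤ n
  · obtain ⟨y, hy1, hy2⟩ := fischer_surj E (D * L) ((k : ℝ) - 2) (by
        intro v hv
        simp only [Module.End.mul_apply]
        rw [hED, hEL, hv]
        simp only [map_add, map_smul]
        module) (by
        intro v hv h0
        refine fischer_inj ((2 * n : ℝ) • (1 : Module.End ℝ V) - E) D L n ?_ ?_
          (2 * n - (k - 2)) v ?_ h0 ?_
        · intro w
          simp only [LinearMap.sub_apply, LinearMap.smul_apply, Module.End.one_apply, hDL]
          module
        · intro w
          simp only [LinearMap.sub_apply, LinearMap.smul_apply, Module.End.one_apply, hED,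
            map_sub, map_smul]
          module
        · simp only [LinearMap.sub_apply, LinearMap.smul_apply, Module.End.one_apply, hv]
          module
        · have : (k : ℝ) ≤ n := by exact_mod_cast hkn
          linarith) (D x) (hDx x hx')
    have hy2' : D (L y) = D x := hy2
    have hmem : x - L y ∈ iSup A := by
      refine Submodule.mem_iSup_of_mem (p := A) ⟨(k, 0), hkn, Nat.zero_le _⟩ ⟨x - L y, ⟨?_, ?_⟩, ?_⟩
      · rw [SetLike.mem_coe, Module.End.mem_eigenspace_iff, map_sub, hx', hEL, hy1, map_smul]
        module
      · rw [SetLike.mem_coe, LinearMap.mem_ker, map_sub, hy2', sub_self]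
      · simp
    have := Submodule.add_mem _ hmem (ih' y hy1)
    simpa using this
  · obtain ⟨y, hy1, hy2⟩ := fischer_surj E (L * D) (k : ℝ) (by
        intro v hv
        simp only [Module.End.mul_apply]
        rw [hEL, hED, hv]
        simp only [map_sub, map_smul]
        module) (by
        intro v hv h0
        exact fischer_inj E L D n hDL hEL _ v hv h0 (by exact_mod_cast not_le.1 hkn)) x hx'
    rw [← hy2]
    exact ih' (D y) (hDx y hy1)

end FischerAbstract


section FischerGrassmann

theorem gDer_gGen_mul {N : ℕ} (i j : Fin N) (y : GrassAlg N) :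
    gDer i (gGen j * y) = (if i = j then (1 : ℝ) else 0) • y - gGen j * gDer i y := by
  have h := CliffordAlgebra.contractLeft_ι_mul (Q := (0 : QuadraticForm ℝ (Fin N → ℝ)))
    (d := LinearMap.proj i) (Pi.single j (1 : ℝ)) y
  refine h.trans ?_
  simp only [LinearMap.proj_apply, Pi.single_apply]
  rfl

theorem gDer_comm {N : ℕ} (i j : Fin N) (y : GrassAlg N) :
    gDer i (gDer j y) = - gDer j (gDer i y) :=
  CliffordAlgebra.contractLeft_comm (Q := (0 : QuadraticForm ℝ (Fin N → ℝ))) _ _ y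

theorem gGen_comm {N : ℕ} (i j : Fin N) (y : GrassAlg N) :
    gGen i * (gGen j * y) = - (gGen j * (gGen i * y)) := by
  rw [← mul_assoc, ← mul_assoc, ← neg_mul]
  congr 1
  exact eq_neg_of_add_eq_zero_left (ExteriorAlgebra.ι_add_mul_swap _ _)

theorem fEuler_apply {N : ℕ} (y : GrassAlg N) :
    fEuler N y = ∑ j : Fin N, gGen j * gDer j y := by
  simp [fEuler, LinearMap.sum_apply]

theorem fEuler_gGen_mul {N : ℕ} (j : Fin N) (y : GrassAlg N) :
    fEuler N (gGen j * y) = gGen j * fEuler N y + gGen j * y := by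
  simp only [fEuler_apply, gDer_gGen_mul, mul_sub, Finset.sum_sub_distrib, Finset.mul_sum]
  simp only [gGen_comm j]
  rw [Finset.sum_neg_distrib]
  simp
  abel

theorem fEuler_gDer {N : ℕ} (j : Fin N) (y : GrassAlg N) :
    fEuler N (gDer j y) = gDer j (fEuler N y) - gDer j y := by
  simp only [fEuler_apply, gDer_gGen_mul, map_sum, Finset.sum_sub_distrib]
  simp only [gDer_comm j, mul_neg]
  rw [Finset.sum_neg_distrib]
  simp [ite_smul, Finset.sum_ite_eq]

theorem thetaSq_mul {n : ℕ} (y : GrassAlg (2 * n)) :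
    thetaSq n * y = - ∑ j : Fin n, gGen (fi1 j) * (gGen (fi2 j) * y) := by
  simp [thetaSq, Finset.sum_mul, mul_assoc]

theorem fLap_apply {n : ℕ} (y : GrassAlg (2 * n)) :
    fLap n y = -(4 : ℝ) • ∑ j : Fin n, gDer (fi1 j) (gDer (fi2 j) y) := by
  simp [fLap, LinearMap.sum_apply]

theorem fi1_inj {n : ℕ} (i j : Fin n) : fi1 i = fi1 j ↔ i = j := by
  simp [fi1, Fin.ext_iff]

theorem fi2_inj {n : ℕ} (i j : Fin n) : fi2 i = fi2 j ↔ i = j := by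
  simp [fi2, Fin.ext_iff]

theorem fi1_ne_fi2 {n : ℕ} (i j : Fin n) : (fi1 i = fi2 j) ↔ False := by
  simp only [fi1, fi2, Fin.ext_iff, iff_false]
  omega

theorem fi2_ne_fi1 {n : ℕ} (i j : Fin n) : (fi2 i = fi1 j) ↔ False := by
  simp only [fi1, fi2, Fin.ext_iff, iff_false]
  omega

theorem gDer_fi1_thetaSq {n : ℕ} (j : Fin n) (y : GrassAlg (2 * n)) :
    gDer (fi1 j) (thetaSq n * y) = thetaSq n * gDer (fi1 j) y - gGen (fi2 j) * y := by
  simp only [thetaSq_mul, map_neg, map_sum, gDer_gGen_mul, fi1_inj, fi1_ne_fi2, mul_sub,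
    Finset.sum_sub_distrib, mul_smul_comm, if_false, zero_smul]
  simp
  abel

theorem gDer_fi2_thetaSq {n : ℕ} (j : Fin n) (y : GrassAlg (2 * n)) :
    gDer (fi2 j) (thetaSq n * y) = thetaSq n * gDer (fi2 j) y + gGen (fi1 j) * y := by
  simp only [thetaSq_mul, map_neg, map_sum, gDer_gGen_mul, fi2_inj, fi2_ne_fi1, mul_sub,
    Finset.sum_sub_distrib, mul_smul_comm, if_false, zero_smul]
  simp
  abel

theorem sum_fi {n : ℕ} {M : Type*} [AddCommMonoid M] (f : Fin (2 * n) → M) :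
    ∑ i, f i = ∑ j : Fin n, (f (fi1 j) + f (fi2 j)) := by
  rw [Finset.sum_add_distrib]
  symm
  refine (Fintype.sum_sum_type (fun s : Fin n ⊕ Fin n => f (Sum.elim fi1 fi2 s))).symm.trans ?_
  refine Function.Bijective.sum_comp (e := Sum.elim (fi1 (n := n)) (fi2 (n := n))) ⟨?_, ?_⟩ f
  · rintro (a | a) (b | b) h
    · exact congrArg _ ((fi1_inj a b).1 h)
    · exact ((fi1_ne_fi2 a b).1 h).elim
    · exact ((fi2_ne_fi1 a b).1 h).elim
    · exact congrArg _ ((fi2_inj a b).1 h)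
  · rintro ⟨i, hi⟩
    rcases Nat.even_or_odd' i with ⟨c, hc | hc⟩
    · exact ⟨Sum.inl ⟨c, by omega⟩, by simp [fi1, hc]⟩
    · exact ⟨Sum.inr ⟨c, by omega⟩, by simp [fi2, hc]⟩

theorem fLap_thetaSq {n : ℕ} (y : GrassAlg (2 * n)) :
    fLap n (thetaSq n * y) =
      thetaSq n * fLap n y + (4 : ℝ) • (fEuler (2 * n) y - (n : ℝ) • y) := by
  have h : ∀ j : Fin n, gDer (fi1 j) (gDer (fi2 j) (thetaSq n * y)) =
      thetaSq n * gDer (fi1 j) (gDer (fi2 j) y)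
        - (gGen (fi1 j) * gDer (fi1 j) y + gGen (fi2 j) * gDer (fi2 j) y) + y := by
    intro j
    rw [gDer_fi2_thetaSq, map_add, gDer_fi1_thetaSq, gDer_gGen_mul, if_pos rfl, one_smul]
    abel
  simp only [fLap_apply, h, Finset.sum_add_distrib, Finset.sum_sub_distrib, fEuler_apply, sum_fi,
    mul_smul_comm, Finset.mul_sum, Finset.sum_const, Finset.card_univ, Fintype.card_fin,
    ← Nat.cast_smul_eq_nsmul ℝ]
  module

theorem fEuler_thetaSq {n : ℕ} (y : GrassAlg (2 * n)) :
    fEuler (2 * n) (thetaSq n * y) = thetaSq n * fEuler (2 * n) y + (2 : ℝ) • (thetaSq n * y) := by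
  simp only [thetaSq_mul, map_neg, map_sum, fEuler_gGen_mul, mul_add, Finset.sum_add_distrib]
  module

theorem fEuler_fLap {n : ℕ} (y : GrassAlg (2 * n)) :
    fEuler (2 * n) (fLap n y) = fLap n (fEuler (2 * n) y) - (2 : ℝ) • fLap n y := by
  simp only [fLap_apply, map_smul, map_sum, fEuler_gDer, map_sub, Finset.sum_sub_distrib]
  module

theorem fEuler_iSup (N : ℕ) : ⨆ k : ℕ, (fEuler N).eigenspace (k : ℝ) = ⊤ := by
  rw [eq_top_iff]
  rintro x -
  refine CliffordAlgebra.left_induction (Q := (0 : QuadraticForm ℝ (Fin N → ℝ)))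
    (P := fun x => x ∈ ⨆ k : ℕ, (fEuler N).eigenspace (k : ℝ)) ?_ ?_ ?_ x
  · intro r
    refine Submodule.mem_iSup_of_mem 0 ?_
    rw [Module.End.mem_eigenspace_iff, fEuler_apply]
    have : ∀ j : Fin N, gDer j (algebraMap ℝ (GrassAlg N) r) = 0 := fun j =>
      CliffordAlgebra.contractLeft_algebraMap (Q := (0 : QuadraticForm ℝ (Fin N → ℝ))) _ r
    rw [Nat.cast_zero, zero_smul]
    exact Finset.sum_eq_zero fun j _ => (congrArg _ (this j)).trans (mul_zero _)
  · intro x y hx hy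
    exact Submodule.add_mem _ hx hy
  · intro x m hx
    have hgen : ∀ (j : Fin N) (x : GrassAlg N), x ∈ ⨆ k : ℕ, (fEuler N).eigenspace (k : ℝ) →
        gGen j * x ∈ ⨆ k : ℕ, (fEuler N).eigenspace (k : ℝ) := by
      intro j x hx
      suffices (⨆ k : ℕ, (fEuler N).eigenspace (k : ℝ)) ≤
        (⨆ k : ℕ, (fEuler N).eigenspace (k : ℝ)).comap (LinearMap.mulLeft ℝ (gGen j)) from this hx
      refine iSup_le fun k y hy => ?_
      refine Submodule.mem_iSup_of_mem (k + 1) ?_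
      rw [Module.End.mem_eigenspace_iff] at hy ⊢
      rw [LinearMap.mulLeft_apply, fEuler_gGen_mul, hy, mul_smul_comm]
      push_cast
      module
    have hm : CliffordAlgebra.ι (0 : QuadraticForm ℝ (Fin N → ℝ)) m =
        ∑ j : Fin N, m j • (gGen j : GrassAlg N) := by
      conv_lhs => rw [pi_eq_sum_univ' m]
      rw [map_sum]
      refine Finset.sum_congr rfl fun j _ => ?_
      rw [map_smul]
      congr 2
    rw [hm, Finset.sum_mul]
    refine Submodule.sum_mem _ fun j _ => ?_
    rw [smul_mul_assoc]
    exact Submodule.smul_mem _ _ (hgen j x hx)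

theorem grassAlg_finite (N : ℕ) : FiniteDimensional ℝ (GrassAlg N) :=
  Module.Finite.of_basis (Pi.basisFun ℝ (Fin N)).ExteriorAlgebra

end FischerGrassmann

/-- the purely fermionic Fischer decomposition
`Λ_{2n} = ⊕_{k=0}^n ⊕_{j=0}^{n-k} θ^{2j} H^f_k`. -/
theorem fermionic_fischer_decomposition (n : ℕ) :
    DirectSum.IsInternal
      (fun p : { p : ℕ × ℕ // p.1 ≤ n ∧ p.2 ≤ n - p.1 } =>
        Submodule.map ((LinearMap.mulLeft ℝ (thetaSq n)) ^ p.1.2) (fHarm n p.1.1)) := by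
  have := grassAlg_finite (2 * n)
  exact fischer_abstract (fEuler (2 * n)) (LinearMap.mulLeft ℝ (thetaSq n)) (fLap n) n
    fLap_thetaSq fEuler_thetaSq fEuler_fLap (fEuler_iSup (2 * n))

end
end

section
/- The Pizzetti functional T(f) = Σ_{k≥0} (2π^{M/2} / (2^{2k} k! Γ(k+M/2))) (∇^{2k} f)(0) on super polynomials satisfies T(R² f) = T(f) for all super polynomials f, provided M = m − 2n is such that Γ(k+M/2) is never at a pole (e.g. M ∉ −2ℕ). -/
open scoped TensorProduct
open MvPolynomial
set_option synthInstance.maxHeartbeats 1000000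
set_option maxHeartbeats 1000000

noncomputable section

variable (m n : ℕ)

/-- The Pizzetti functional
`T(f) = Σ_k (2π^{M/2}/(2^{2k} k! Γ(k+M/2))) (∇^{2k}f)(0)`. -/
def pizzetti (m n : ℕ) (f : SP m n) : ℝ :=
  ∑' k : ℕ,
    (2 * Real.pi ^ (((m : ℝ) - 2 * n) / 2) /
        (2 ^ (2 * k) * (k.factorial : ℝ) *
          Real.Gamma ((k : ℝ) + ((m : ℝ) - 2 * n) / 2))) *
      scalarPart m n (((superLap m n) ^ k) f)

section aux

theorem aux_sum_comm {A ι : Type*} [Ring A] [Fintype ι] [DecidableEq ι] (D X C : ι → A)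
    (h : ∀ i k, i ≠ k → D i * X k = X k * D i) (h' : ∀ i, D i * X i = X i * D i + C i) :
    (∑ i, D i) * (∑ i, X i) = (∑ i, X i) * (∑ i, D i) + ∑ i, C i := by
  rw [Finset.sum_mul_sum, Finset.sum_mul_sum, Finset.sum_comm (γ := ι) (f := fun i j => X i * D j),
    ← Finset.sum_add_distrib]
  refine Finset.sum_congr rfl fun i _ => ?_
  have : C i = ∑ j, if i = j then C i else 0 := by simp
  rw [this, ← Finset.sum_add_distrib]
  refine Finset.sum_congr rfl fun k _ => ?_
  by_cases hik : i = k
  · subst hik; simp [h']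
  · simp [hik, h i k hik]

theorem aux_sum_commute {A ι κ : Type*} [Ring A] [Fintype ι] [Fintype κ] (D : ι → A) (X : κ → A)
    (h : ∀ i k, D i * X k = X k * D i) :
    (∑ i, D i) * (∑ i, X i) = (∑ i, X i) * (∑ i, D i) := by
  have : Commute (∑ i, D i) (∑ i, X i) :=
    Commute.sum_left _ _ _ fun i _ => Commute.sum_right _ _ _ fun k _ => h i k
  exact this

theorem aux_pow {A : Type*} [Ring A] [Algebra ℝ A] (L R E : A) (c : ℝ)
    (h1 : L * R = R * L + (4 : ℝ) • E + c • (1 : A)) (h2 : L * E = E * L + (2 : ℝ) • L) (k : ℕ) :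
    L ^ (k + 1) * R = R * L ^ (k + 1) + (4 * (k + 1 : ℝ)) • (E * L ^ k)
      + (4 * (k + 1 : ℝ) * k + c * (k + 1)) • L ^ k := by
  induction k with
  | zero => simp [h1]
  | succ k ih =>
    have e1 : L * (R * L ^ (k + 1)) = R * L ^ (k + 2) + (4 : ℝ) • (E * L ^ (k + 1))
        + c • L ^ (k + 1) := by
      rw [← mul_assoc, h1, pow_succ' L (k + 1)]; simp [add_mul, mul_assoc]
    have e2 : L * (E * L ^ k) = E * L ^ (k + 1) + (2 : ℝ) • L ^ (k + 1) := by
      rw [← mul_assoc, h2, pow_succ' L k]; simp [add_mul, mul_assoc]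
    rw [pow_succ' L (k + 1), mul_assoc, ih, mul_add, mul_add, e1, mul_smul_comm, mul_smul_comm, e2,
      ← pow_succ' L k, ← pow_succ' L (k + 1)]
    push_cast
    module

/-- two anticommutations give a commutation -/
theorem aux_anti {A : Type*} [Ring A] {a b c : A} (h1 : a * b = -(b * a)) (h2 : a * c = -(c * a)) :
    a * (b * c) = (b * c) * a := by
  rw [← mul_assoc, h1, neg_mul, mul_assoc, h2]; simp [mul_assoc]

theorem aux_anti4 {A : Type*} [Ring A] {a a' b c : A}
    (h1 : a * b = -(b * a)) (h2 : a * c = -(c * a))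
    (h3 : a' * b = -(b * a')) (h4 : a' * c = -(c * a')) :
    (a * a') * (b * c) = (b * c) * (a * a') := by
  rw [mul_assoc, aux_anti h3 h4, ← mul_assoc, aux_anti h1 h2, mul_assoc]

theorem aux_b {A : Type*} [Ring A] [Algebra ℝ A] {x d : A} (h : d * x = x * d + 1) :
    (d * d) * (x * x) = (x * x) * (d * d) + ((4 : ℝ) • (x * d) + (2 : ℝ) • (1 : A)) := by
  have e1 : d * (x * x) = (x * x) * d + (2 : ℝ) • x := by
    rw [← mul_assoc, h, add_mul, mul_assoc, h, mul_add, one_mul, two_smul, mul_one, mul_assoc]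
    abel
  rw [mul_assoc, e1, mul_add, ← mul_assoc, e1, mul_smul_comm, h]
  simp only [add_mul, smul_mul_assoc, mul_assoc]
  module

theorem aux_bE {A : Type*} [Ring A] [Algebra ℝ A] {x d : A} (h : d * x = x * d + 1) :
    (d * d) * (x * d) = (x * d) * (d * d) + (2 : ℝ) • (d * d) := by
  have e1 : d * (x * d) = x * d * d + d := by
    rw [← mul_assoc, h, add_mul, one_mul]
  rw [mul_assoc, e1, mul_add, ← mul_assoc, e1, two_smul, add_mul]
  simp only [mul_assoc]; abel

theorem aux_f {A : Type*} [Ring A] [Algebra ℝ A] {y1 y2 e1 e2 : A}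
    (h11 : e1 * y1 = 1 - y1 * e1) (h22 : e2 * y2 = 1 - y2 * e2)
    (h12 : e1 * y2 = -(y2 * e1)) (h21 : e2 * y1 = -(y1 * e2)) :
    (e1 * e2) * (y1 * y2) = (y1 * y2) * (e1 * e2) + (y1 * e1 + y2 * e2 - 1) := by
  have a : (e1 * e2) * (y1 * y2) = - ((e1 * y1) * (e2 * y2)) := by
    rw [mul_assoc, ← mul_assoc e2, h21]; simp [mul_assoc]
  have b : (y1 * e1) * (y2 * e2) = -((y1 * y2) * (e1 * e2)) := by
    rw [mul_assoc, ← mul_assoc e1, h12]; simp [mul_assoc]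
  rw [a, h11, h22, sub_mul, mul_sub, mul_sub, b]
  simp only [one_mul, mul_one]; abel

theorem aux_fE {A : Type*} [Ring A] [Algebra ℝ A] {y1 y2 e1 e2 : A}
    (h11 : e1 * y1 = 1 - y1 * e1) (h22 : e2 * y2 = 1 - y2 * e2)
    (h12 : e1 * y2 = -(y2 * e1)) (h21 : e2 * y1 = -(y1 * e2))
    (e11 : e1 * e1 = 0) (e22 : e2 * e2 = 0) (e21 : e2 * e1 = - (e1 * e2)) :
    (e1 * e2) * (y1 * e1 + y2 * e2) = (y1 * e1 + y2 * e2) * (e1 * e2) + (2 : ℝ) • (e1 * e2) := by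
  have a : (e1 * e2) * (y1 * e1) = e1 * e2 := by
    have : (e1 * e2) * (y1 * e1) = - ((e1 * y1) * (e2 * e1)) := by
      rw [mul_assoc, ← mul_assoc e2, h21]; simp [mul_assoc]
    rw [this, h11, e21, sub_mul, mul_neg, mul_neg, mul_assoc y1, ← mul_assoc e1 e1, e11]; simp
  have b : (e1 * e2) * (y2 * e2) = e1 * e2 := by
    rw [mul_assoc, ← mul_assoc e2, h22, sub_mul, mul_assoc y2, e22]; simp
  have c : (y1 * e1) * (e1 * e2) = 0 := by
    rw [mul_assoc, ← mul_assoc e1, e11]; simp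
  have d : (y2 * e2) * (e1 * e2) = 0 := by
    rw [mul_assoc, ← mul_assoc e2, e21, neg_mul, mul_assoc, e22]; simp
  rw [mul_add, add_mul, a, b, c, d, two_smul]; simp

/-- abstract super sl2 relations -/
theorem aux_super {A : Type*} [Ring A] [Algebra ℝ A] {ι κ : Type*} [Fintype ι] [DecidableEq ι]
    [Fintype κ] [DecidableEq κ] (x d : ι → A) (y1 y2 e1 e2 : κ → A)
    (hdx : ∀ i, d i * x i = x i * d i + 1) (hdx' : ∀ i k, i ≠ k → d i * x k = x k * d i)
    (hdd : ∀ i k, d i * d k = d k * d i)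
    (h11 : ∀ i, e1 i * y1 i = 1 - y1 i * e1 i) (h22 : ∀ i, e2 i * y2 i = 1 - y2 i * e2 i)
    (h12 : ∀ i k, e1 i * y2 k = -(y2 k * e1 i)) (h21 : ∀ i k, e2 i * y1 k = -(y1 k * e2 i))
    (h11' : ∀ i k, i ≠ k → e1 i * y1 k = -(y1 k * e1 i))
    (h22' : ∀ i k, i ≠ k → e2 i * y2 k = -(y2 k * e2 i))
    (f11 : ∀ i k, e1 i * e1 k = -(e1 k * e1 i)) (f22 : ∀ i k, e2 i * e2 k = -(e2 k * e2 i))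
    (f12 : ∀ i k, e1 i * e2 k = -(e2 k * e1 i))
    (f11' : ∀ i, e1 i * e1 i = 0) (f22' : ∀ i, e2 i * e2 i = 0)
    (c3 : ∀ i k, Commute (x i) (e1 k)) (c4 : ∀ i k, Commute (x i) (e2 k))
    (c5 : ∀ i k, Commute (d i) (y1 k)) (c6 : ∀ i k, Commute (d i) (y2 k))
    (c7 : ∀ i k, Commute (d i) (e1 k)) (c8 : ∀ i k, Commute (d i) (e2 k))
    (L R E : A)
    (hL : L = ∑ i, d i * d i - (4 : ℝ) • ∑ j, e1 j * e2 j)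
    (hR : R = ∑ i, x i * x i - ∑ j, y1 j * y2 j)
    (hE : E = ∑ i, x i * d i + ∑ j, (y1 j * e1 j + y2 j * e2 j)) :
    L * R = R * L + (4 : ℝ) • E + (2 * ((Fintype.card ι : ℝ) - 2 * (Fintype.card κ : ℝ))) • (1 : A) ∧
    L * E = E * L + (2 : ℝ) • L := by
  have b1 := aux_sum_comm (fun i => d i * d i) (fun i => x i * x i) _
    (fun i k h => ((Commute.mul_left (hdx' i k h) (hdx' i k h)).mul_right
      (Commute.mul_left (hdx' i k h) (hdx' i k h)) : Commute _ _)) (fun i => aux_b (hdx i))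
  have b2 := aux_sum_comm (fun i => d i * d i) (fun i => x i * d i) _
    (fun i k h => ((Commute.mul_left (hdx' i k h) (hdx' i k h)).mul_right
      (Commute.mul_left (hdd i k) (hdd i k)) : Commute _ _)) (fun i => aux_bE (hdx i))
  have f1 := aux_sum_comm (fun i => e1 i * e2 i) (fun i => y1 i * y2 i) _
    (fun i k h => aux_anti4 (h11' i k h) (h12 i k) (h21 i k) (h22' i k h))
    (fun i => aux_f (h11 i) (h22 i) (h12 i i) (h21 i i))
  have f21 : ∀ i k, e2 i * e1 k = -(e1 k * e2 i) := fun i k => by rw [f12]; simp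
  have f2 := aux_sum_comm (fun i => e1 i * e2 i) (fun i => y1 i * e1 i + y2 i * e2 i) _
    (fun i k h => by
      rw [mul_add, add_mul, aux_anti4 (h11' i k h) (f11 i k) (h21 i k) (f21 i k),
        aux_anti4 (h12 i k) (f12 i k) (h22' i k h) (f22 i k)])
    (fun i => aux_fE (h11 i) (h22 i) (h12 i i) (h21 i i) (f11' i) (f22' i) (f21 i i))
  have m1 := aux_sum_commute (fun i => d i * d i) (fun i => y1 i * y2 i) (fun i k =>
    ((c5 i k).mul_left (c5 i k)).mul_right ((c6 i k).mul_left (c6 i k)))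
  have m2 := aux_sum_commute (fun i => e1 i * e2 i) (fun i => x i * x i) (fun i k =>
    (((c3 k i).mul_left (c3 k i)).mul_right ((c4 k i).mul_left (c4 k i))).symm)
  have m3 := aux_sum_commute (fun i => d i * d i) (fun i => y1 i * e1 i + y2 i * e2 i) (fun i k =>
    (((c5 i k).mul_left (c5 i k)).mul_right ((c7 i k).mul_left (c7 i k))).add_right
    (((c6 i k).mul_left (c6 i k)).mul_right ((c8 i k).mul_left (c8 i k))))
  have m4 := aux_sum_commute (fun i => e1 i * e2 i) (fun i => x i * d i) (fun i k =>
    (((c3 k i).mul_left (c7 k i)).mul_right ((c4 k i).mul_left (c8 k i))).symm)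
  simp only [Finset.sum_add_distrib (f := fun i => (4 : ℝ) • _), ← Finset.smul_sum,
    Finset.sum_sub_distrib, Finset.sum_const, Finset.card_univ] at b1 b2 f1 f2
  rw [← Nat.cast_smul_eq_nsmul ℝ] at b1 f1
  generalize (∑ j, (y1 j * e1 j + y2 j * e2 j)) = Ef at *
  generalize (∑ j, x j * d j) = Eb at *
  generalize (∑ j, x j * x j) = Rb at *
  generalize (∑ j, d j * d j) = Lb at *
  generalize (∑ j, e1 j * e2 j) = Lf at *
  generalize (∑ j, y1 j * y2 j) = Rf at *
  subst hL hR hE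
  constructor
  · simp only [sub_mul, mul_sub, smul_mul_assoc, mul_smul_comm, b1, f1, m1, m2]
    module
  · simp only [sub_mul, mul_sub, mul_add, add_mul, smul_mul_assoc, mul_smul_comm, b2, f2, m3, m4]
    module

theorem aux_bf {P G : Type*} [AddCommGroup P] [AddCommGroup G] [Module ℝ P] [Module ℝ G]
    (a : Module.End ℝ P) (b : Module.End ℝ G) :
    Commute (S := Module.End ℝ (P ⊗[ℝ] G)) (LinearMap.rTensor G a) (LinearMap.lTensor P b) := by
  refine TensorProduct.ext' fun p g => ?_
  simp

theorem aux_xe (i : Fin m) (k : Fin (2 * n)) : Commute (bvar m n i) (fderSP m n k) := by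
  unfold bvar fderSP; exact aux_bf _ _

theorem aux_dy (i : Fin m) (k : Fin (2 * n)) : Commute (bder m n i) (fvar m n k) := by
  unfold bder fvar; exact aux_bf _ _

theorem aux_de (i : Fin m) (k : Fin (2 * n)) : Commute (bder m n i) (fderSP m n k) := by
  unfold bder fderSP; exact aux_bf _ _

theorem aux_gDer_gGen {N : ℕ} (i k : Fin N) (g : GrassAlg N) :
    gDer i (gGen k * g) = (if i = k then g else 0) - gGen k * gDer i g := by
  have := CliffordAlgebra.contractLeft_ι_mul (Q := (0 : QuadraticForm ℝ (Fin N → ℝ)))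
    (LinearMap.proj i) (Pi.single k 1) g
  refine this.trans ?_
  by_cases h : i = k
  · subst h; simp [gGen, gDer]
  · simp [gGen, gDer, h]

theorem aux_ey (i : Fin (2 * n)) :
    fderSP m n i * fvar m n i = 1 - fvar m n i * fderSP m n i := by
  refine TensorProduct.ext' fun p g => ?_
  simp [fderSP, fvar, aux_gDer_gGen, TensorProduct.tmul_sub]

theorem aux_ey' (i k : Fin (2 * n)) (h : i ≠ k) :
    fderSP m n i * fvar m n k = -(fvar m n k * fderSP m n i) := by
  refine TensorProduct.ext' fun p g => ?_
  simp [fderSP, fvar, aux_gDer_gGen, TensorProduct.tmul_neg, h]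

theorem aux_ee (i k : Fin (2 * n)) :
    fderSP m n i * fderSP m n k = -(fderSP m n k * fderSP m n i) := by
  refine TensorProduct.ext' fun p g => ?_
  have : gDer i (gDer k g) = - gDer k (gDer i g) := CliffordAlgebra.contractLeft_comm _ _ _
  simp [fderSP, this, TensorProduct.tmul_neg]

theorem aux_ee0 (i : Fin (2 * n)) :
    fderSP m n i * fderSP m n i = 0 := by
  refine TensorProduct.ext' fun p g => ?_
  have : gDer i (gDer i g) = 0 := CliffordAlgebra.contractLeft_contractLeft _ _
  simp [fderSP, this]

theorem aux_dx (i : Fin m) : bder m n i * bvar m n i = bvar m n i * bder m n i + 1 := by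
  refine TensorProduct.ext' fun p g => ?_
  simp [bder, bvar, TensorProduct.add_tmul]

theorem aux_dx' (i k : Fin m) (h : i ≠ k) :
    bder m n i * bvar m n k = bvar m n k * bder m n i := by
  refine TensorProduct.ext' fun p g => ?_
  simp [bder, bvar, pderiv_X_of_ne h.symm]

theorem aux_dd (i k : Fin m) : bder m n i * bder m n k = bder m n k * bder m n i := by
  refine TensorProduct.ext' fun p g => ?_
  have : pderiv i (pderiv k p) = pderiv k (pderiv i p) := by
    have h : ⁅(pderiv i : Derivation ℝ (MvPolynomial (Fin m) ℝ) (MvPolynomial (Fin m) ℝ)),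
        (pderiv k : Derivation ℝ (MvPolynomial (Fin m) ℝ) (MvPolynomial (Fin m) ℝ))⁆ = 0 := by
      refine MvPolynomial.derivation_ext fun j => ?_
      rw [Derivation.commutator_apply]
      simp only [pderiv_X, Pi.single_apply]
      split_ifs <;> simp
    have h2 := congrArg (fun D : Derivation ℝ (MvPolynomial (Fin m) ℝ) (MvPolynomial (Fin m) ℝ) => D p) h
    simpa [Derivation.commutator_apply, sub_eq_zero] using h2
  simp [bder, this]

theorem aux_R : mulRSq m n = ∑ i, bvar m n i * bvar m n i
    - ∑ j, fvar m n (fi1 j) * fvar m n (fi2 j) := by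
  refine TensorProduct.ext' fun p g => ?_
  have hn : (1 : MvPolynomial (Fin m) ℝ) ⊗ₜ[ℝ] thetaSq n * p ⊗ₜ[ℝ] g
      = p ⊗ₜ[ℝ] (thetaSq n * g) := by
    rw [Algebra.TensorProduct.tmul_mul_tmul, one_mul]
  simp only [mulRSq, rSq, LinearMap.mulLeft_apply, add_mul, hn]
  simp [rSq, bvar, fvar, thetaSq, add_mul, neg_mul, TensorProduct.tmul_neg, Finset.sum_mul,
    TensorProduct.tmul_sum, TensorProduct.sum_tmul, mul_assoc, LinearMap.sum_apply, sub_eq_add_neg]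

theorem aux_bvar_apply (i : Fin m) (f : SP m n) : bvar m n i f = ((X i) ⊗ₜ[ℝ] 1) * f := by
  have : bvar m n i = LinearMap.mulLeft ℝ ((X i) ⊗ₜ[ℝ] 1) := by
    refine TensorProduct.ext' fun p g => ?_
    simp [bvar]
  rw [this]; rfl

theorem aux_fvar_apply (i : Fin (2 * n)) (f : SP m n) :
    fvar m n i f = (1 ⊗ₜ[ℝ] gGen i) * f := by
  have : fvar m n i = LinearMap.mulLeft ℝ (1 ⊗ₜ[ℝ] gGen i) := by
    refine TensorProduct.ext' fun p g => ?_
    simp [fvar]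
  rw [this]; rfl

theorem aux_sb (i : Fin m) (f : SP m n) : scalarPart m n (bvar m n i f) = 0 := by
  rw [aux_bvar_apply, map_mul]; simp [scalarPart]

theorem aux_sf (i : Fin (2 * n)) (f : SP m n) : scalarPart m n (fvar m n i f) = 0 := by
  rw [aux_fvar_apply, map_mul]; simp [scalarPart, gGen, ExteriorAlgebra.algebraMapInv]

/-- The Euler operator with the fermionic part summed in pairs. -/
def auxE : Module.End ℝ (SP m n) :=
  ∑ i, bvar m n i * bder m n i + ∑ j : Fin n, (fvar m n (fi1 j) * fderSP m n (fi1 j)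
    + fvar m n (fi2 j) * fderSP m n (fi2 j))

theorem aux_sE (f : SP m n) : scalarPart m n (auxE m n f) = 0 := by
  simp [auxE, LinearMap.sum_apply, aux_sb, aux_sf]

theorem aux_sR (f : SP m n) : scalarPart m n (mulRSq m n f) = 0 := by
  simp [aux_R, LinearMap.sum_apply, aux_sb, aux_sf]

theorem aux_rel :
    superLap m n * mulRSq m n = mulRSq m n * superLap m n + (4 : ℝ) • auxE m n
      + (2 * ((m : ℝ) - 2 * n)) • (1 : Module.End ℝ (SP m n)) ∧
    superLap m n * auxE m n = auxE m n * superLap m n + (2 : ℝ) • superLap m n := by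
  have n12 : ∀ i k : Fin n, (fi1 i : Fin (2 * n)) ≠ fi2 k := fun i k h => by
    simp only [fi1, fi2, Fin.mk.injEq] at h; omega
  have n11 : ∀ i k : Fin n, i ≠ k → (fi1 i : Fin (2 * n)) ≠ fi1 k := fun i k hh h => by
    simp only [fi1, Fin.mk.injEq] at h; apply hh; ext; omega
  have n22 : ∀ i k : Fin n, i ≠ k → (fi2 i : Fin (2 * n)) ≠ fi2 k := fun i k hh h => by
    simp only [fi2, Fin.mk.injEq] at h; apply hh; ext; omega
  have := aux_super (bvar m n) (bder m n) (fun j => fvar m n (fi1 j)) (fun j => fvar m n (fi2 j))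
    (fun j => fderSP m n (fi1 j)) (fun j => fderSP m n (fi2 j))
    (aux_dx m n) (aux_dx' m n) (aux_dd m n) (fun i => aux_ey m n _) (fun i => aux_ey m n _)
    (fun i k => aux_ey' m n _ _ (n12 i k)) (fun i k => aux_ey' m n _ _ (n12 k i).symm)
    (fun i k h => aux_ey' m n _ _ (n11 i k h)) (fun i k h => aux_ey' m n _ _ (n22 i k h))
    (fun i k => aux_ee m n _ _) (fun i k => aux_ee m n _ _) (fun i k => aux_ee m n _ _)
    (fun i => aux_ee0 m n _) (fun i => aux_ee0 m n _)
    (fun i k => aux_xe m n _ _) (fun i k => aux_xe m n _ _) (fun i k => aux_dy m n _ _)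
    (fun i k => aux_dy m n _ _) (fun i k => aux_de m n _ _) (fun i k => aux_de m n _ _)
    (superLap m n) (mulRSq m n) (auxE m n) rfl (aux_R m n) rfl
  simpa only [Fintype.card_fin] using this

theorem aux_step (f : SP m n) (k : ℕ) :
    scalarPart m n ((superLap m n ^ (k + 1)) (rSq m n * f)) =
      4 * (k + 1 : ℝ) * (k + ((m : ℝ) - 2 * n) / 2) * scalarPart m n ((superLap m n ^ k) f) := by
  have h := aux_pow (A := Module.End ℝ (SP m n)) _ _ _ _ (aux_rel m n).1 (aux_rel m n).2 k
  have h3 : (superLap m n ^ (k + 1)) (rSq m n * f) = (superLap m n ^ (k + 1) * mulRSq m n) f := rfl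
  rw [h3, h]
  simp only [LinearMap.add_apply, LinearMap.smul_apply, Module.End.mul_apply, map_add, map_smul,
    aux_sR, aux_sE, smul_eq_mul]
  ring

end aux

/-- `T(R² f) = T(f)` when `M ∉ -2ℕ`. -/
theorem pizzetti_rsq (m n : ℕ) (hM : ∀ j : ℕ, (m : ℤ) - 2 * n ≠ -2 * j)
    (f : SP m n) :
    pizzetti m n (rSq m n * f) = pizzetti m n f := by
  unfold pizzetti
  rw [← (Nat.succ_injective).tsum_eq (f := fun k : ℕ =>
    (2 * Real.pi ^ (((m : ℝ) - 2 * n) / 2) /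
        (2 ^ (2 * k) * (k.factorial : ℝ) *
          Real.Gamma ((k : ℝ) + ((m : ℝ) - 2 * n) / 2))) *
      scalarPart m n (((superLap m n) ^ k) (rSq m n * f)))]
  · refine tsum_congr fun k => ?_
    have hne : ∀ j : ℕ, (k : ℝ) + ((m : ℝ) - 2 * n) / 2 ≠ -j := by
      intro j hj
      apply hM (j + k)
      have : (m : ℝ) - 2 * n = -2 * (j + k) := by linarith
      exact_mod_cast this
    have h0 : (k : ℝ) + ((m : ℝ) - 2 * n) / 2 ≠ 0 := by simpa using hne 0
    have hG := Real.Gamma_ne_zero hne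
    have hG1 := Real.Gamma_add_one h0
    have e : ((k.succ : ℕ) : ℝ) + ((m : ℝ) - 2 * n) / 2
        = (k : ℝ) + ((m : ℝ) - 2 * n) / 2 + 1 := by push_cast; ring
    rw [e, hG1, Nat.succ_eq_add_one, aux_step, Nat.factorial_succ]
    generalize (k : ℝ) + ((m : ℝ) - 2 * n) / 2 = z at *
    have hk : ((k : ℝ) + 1) ≠ 0 := by positivity
    have hk' : (k.factorial : ℝ) ≠ 0 := by positivity
    push_cast
    rw [mul_add 2 k 1, pow_add]
    field_simp
    ring
  · intro k hk
    rcases k with _ | k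
    · exfalso; apply hk
      have := aux_sR m n f
      simp only [pow_zero, Module.End.one_apply]
      rw [show rSq m n * f = mulRSq m n f from rfl, this, mul_zero]
    · exact ⟨k, rfl⟩

end
end
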